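/- arXiv:2007.07809 — 5 statements merged into one kernel-verified Lean document; each statement's English description precedes it below -/
import Mathlib

section
/- For every integer ν, the integral of ρ_t over the ball {x ∈ ℚ_p : ‖x‖ ≤ p^ν} equals e^{−σ t p^{−ν b}} + Σ_{r ∈ ℤ, r ≤ −ν−1} p^{ν+r} (e^{−σ t p^{r b}} − e^{−σ t p^{(r+1) b}}). -/
open MeasureTheory ENNReal

/-- The fundamental solution (transition density) of the `p`-adic diffusion equation for
the Vladimirov operator with exponent `b` and diffusion constant `σ`:
`ρ_t(x) = Σ_{r ∈ ℤ} (e^{−σtp^{rb}} − e^{−σtp^{(r+1)b}}) · p^r · 1_{‖x‖ ≤ p^{−r}}(x)`. -/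
noncomputable def rho (p : ℕ) [Fact p.Prime] (b σ t : ℝ) (x : ℚ_[p]) : ℝ :=
  ∑' r : ℤ,
    (Real.exp (-(σ * t * (p : ℝ) ^ ((r : ℝ) * b))) -
        Real.exp (-(σ * t * (p : ℝ) ^ (((r : ℝ) + 1) * b)))) *
      ((p : ℝ) ^ r *
        Set.indicator {y : ℚ_[p] | ‖y‖ ≤ (p : ℝ) ^ (-r)} (fun _ => (1 : ℝ)) x)

theorem padic_closedBall_zpow_eq_iUnion (p : ℕ) [Fact p.Prime] (n : ℤ) :
    {x : ℚ_[p] | ‖x‖ ≤ (p : ℝ) ^ (n + 1)} =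
      ⋃ i ∈ Finset.range p,
        (fun x => -((i : ℚ_[p]) * (p : ℚ_[p]) ^ (-(n + 1))) + x) ⁻¹'
          {x : ℚ_[p] | ‖x‖ ≤ (p : ℝ) ^ n} := by
  have hp0 : (0 : ℝ) < p := by exact_mod_cast (Fact.out : p.Prime).pos
  have hp1 : (1 : ℝ) ≤ p := by exact_mod_cast (Fact.out : p.Prime).one_le
  have hpq : (p : ℚ_[p]) ≠ 0 := by exact_mod_cast (Fact.out : p.Prime).ne_zero
  ext x
  simp only [Set.mem_ofPred_eq, Set.mem_iUnion, Set.mem_preimage, exists_prop, Finset.mem_range]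
  constructor
  · intro hx
    have hy : ‖x * (p : ℚ_[p]) ^ (n + 1)‖ ≤ 1 := by
      rw [norm_mul, Padic.norm_p_zpow, zpow_neg, ← div_eq_mul_inv]
      exact div_le_one_of_le₀ hx (by positivity)
    obtain ⟨i, hi, hmem⟩ := PadicInt.exists_mem_range (⟨_, hy⟩ : ℤ_[p])
    refine ⟨i, hi, ?_⟩
    rw [PadicInt.maximalIdeal_eq_span_p, ← pow_one (p : ℤ_[p]),
      ← PadicInt.norm_le_pow_iff_mem_span_pow] at hmem
    have hmem' : ‖x * (p : ℚ_[p]) ^ (n + 1) - i‖ ≤ (p : ℝ) ^ (-1 : ℤ) := by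
      rw [PadicInt.norm_def] at hmem
      exact_mod_cast hmem
    have hfac : -((i : ℚ_[p]) * (p : ℚ_[p]) ^ (-(n + 1))) + x
        = (x * (p : ℚ_[p]) ^ (n + 1) - i) * (p : ℚ_[p]) ^ (-(n + 1)) := by
      rw [sub_mul, mul_assoc, ← zpow_add₀ hpq]
      simp
      ring
    rw [hfac, norm_mul, Padic.norm_p_zpow]
    calc _ ≤ (p : ℝ) ^ (-1 : ℤ) * (p : ℝ) ^ (- -(n + 1)) := by gcongr
      _ = (p : ℝ) ^ n := by rw [← zpow_add₀ hp0.ne']; congr 1; ring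
  · rintro ⟨i, -, hi⟩
    have hx : x = (i : ℚ_[p]) * (p : ℚ_[p]) ^ (-(n + 1)) +
      (-((i : ℚ_[p]) * (p : ℚ_[p]) ^ (-(n + 1))) + x) := by ring
    rw [hx]
    refine (Padic.nonarchimedean _ _).trans (max_le ?_ (hi.trans ?_))
    · rw [norm_mul, Padic.norm_p_zpow, neg_neg]
      have : ‖(i : ℚ_[p])‖ ≤ 1 := by simpa using Padic.norm_int_le_one (p := p) (i : ℤ)
      exact mul_le_of_le_one_left (by positivity) this
    · exact zpow_le_zpow_right₀ hp1 (by lia)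

theorem padic_measurableSet_closedBall (p : ℕ) [Fact p.Prime]
    [MeasurableSpace ℚ_[p]] [BorelSpace ℚ_[p]] (c : ℝ) :
    MeasurableSet {x : ℚ_[p] | ‖x‖ ≤ c} :=
  (isClosed_le continuous_norm continuous_const).measurableSet

theorem padic_measure_closedBall_zpow_succ (p : ℕ) [Fact p.Prime]
    [MeasurableSpace ℚ_[p]] [BorelSpace ℚ_[p]]
    (μ : Measure ℚ_[p]) [Measure.IsAddLeftInvariant μ] (n : ℤ) :
    μ.real {x : ℚ_[p] | ‖x‖ ≤ (p : ℝ) ^ (n + 1)} =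
      p * μ.real {x : ℚ_[p] | ‖x‖ ≤ (p : ℝ) ^ n} := by
  have hp0 : (0 : ℝ) < p := by exact_mod_cast (Fact.out : p.Prime).pos
  have hp1 : (1 : ℝ) < p := by exact_mod_cast (Fact.out : p.Prime).one_lt
  rw [padic_closedBall_zpow_eq_iUnion, Measure.real, measure_biUnion_finset]
  · simp only [measure_preimage_add]
    simp [Measure.real]
  · intro i hi j hj hij
    refine Set.disjoint_left.2 fun x hxi hxj => ?_
    simp only [Set.mem_preimage, Set.mem_ofPred_eq] at hxi hxj
    have hsub : ‖((i : ℤ) - (j : ℤ) : ℤ) * (p : ℚ_[p]) ^ (-(n + 1))‖ ≤ (p : ℝ) ^ n := by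
      have heq : (((i : ℤ) - (j : ℤ) : ℤ) : ℚ_[p]) * (p : ℚ_[p]) ^ (-(n + 1)) =
        (-((j : ℚ_[p]) * (p : ℚ_[p]) ^ (-(n + 1))) + x) +
          -(-((i : ℚ_[p]) * (p : ℚ_[p]) ^ (-(n + 1))) + x) := by push_cast; ring
      rw [heq]
      exact (Padic.nonarchimedean _ _).trans (max_le hxj (by rwa [norm_neg]))
    rw [norm_mul, Padic.norm_p_zpow, neg_neg, zpow_add_one₀ hp0.ne'] at hsub
    have hlt : ‖(((i : ℤ) - (j : ℤ) : ℤ) : ℚ_[p])‖ < 1 := by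
      by_contra! h
      have : (0 : ℝ) < (p : ℝ) ^ n := by positivity
      nlinarith [mul_le_mul_of_nonneg_right h (by positivity : 0 ≤ (p : ℝ) ^ n * p)]
    rw [Padic.norm_intCast_lt_one_iff] at hlt
    have hi' := Finset.mem_range.1 hi
    have hj' := Finset.mem_range.1 hj
    refine hij ?_
    have := Int.eq_zero_of_abs_lt_dvd hlt (by rw [abs_lt]; constructor <;> lia)
    lia
  · intro i _
    exact measurable_const_add _ (padic_measurableSet_closedBall p _)

theorem padic_measure_closedBall_zpow (p : ℕ) [Fact p.Prime]
    [MeasurableSpace ℚ_[p]] [BorelSpace ℚ_[p]]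
    (μ : Measure ℚ_[p]) [Measure.IsAddLeftInvariant μ]
    (hμ : μ {x : ℚ_[p] | ‖x‖ ≤ 1} = 1) (n : ℤ) :
    μ.real {x : ℚ_[p] | ‖x‖ ≤ (p : ℝ) ^ n} = (p : ℝ) ^ n := by
  have hp0 : (p : ℝ) ≠ 0 := by exact_mod_cast (Fact.out : p.Prime).ne_zero
  induction n using Int.induction_on with
  | zero => simp [Measure.real, hμ]
  | succ n ih => rw [padic_measure_closedBall_zpow_succ, ih, zpow_add_one₀ hp0, mul_comm]
  | pred n ih =>
    have h := padic_measure_closedBall_zpow_succ p μ (-(n : ℤ) - 1)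
    rw [sub_add_cancel, ih] at h
    refine mul_left_cancel₀ hp0 ?_
    rw [← h, ← zpow_one_add₀ hp0, add_sub_cancel]

/-- The decay factor `e^{−cp^{rb}}` decreases in `r`. -/
theorem antitone_exp_neg_mul_rpow {c q b : ℝ} (hc : 0 ≤ c) (hq : 1 ≤ q) (hb : 0 ≤ b) :
    Antitone fun r : ℝ => Real.exp (-(c * q ^ (r * b))) := by
  intro r s hrs
  dsimp only
  gcongr

theorem tendsto_exp_neg_mul_rpow {c q b : ℝ} (hc : 0 < c) (hq : 1 < q) (hb : 0 < b) :
    Filter.Tendsto (fun r : ℝ => Real.exp (-(c * q ^ (r * b)))) Filter.atTop (nhds 0) := by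
  refine Real.tendsto_exp_neg_atTop_nhds_zero.comp ?_
  refine Filter.Tendsto.const_mul_atTop hc ?_
  exact (tendsto_rpow_atTop_of_base_gt_one q hq).comp
    (Filter.Tendsto.atTop_mul_const hb Filter.tendsto_id)

theorem hasSum_int_split {f : ℤ → ℝ} {m : ℝ} (k : ℤ)
    (h₁ : HasSum (fun n : ℕ => f (n + k)) m)
    (h₂ : Summable fun n : ℕ => f (-(n + 1) + k)) :
    HasSum f (m + ∑' r : {r : ℤ // r ≤ k - 1}, f r.1) := by
  have e : ∑' r : {r : ℤ // r ≤ k - 1}, f r.1 = ∑' n : ℕ, f (-(n + 1) + k) := by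
    let e : ℕ ≃ {r : ℤ // r ≤ k - 1} :=
      { toFun n := ⟨-(n + 1) + k, by lia⟩
        invFun r := (k - 1 - r.1).toNat
        left_inv n := by dsimp only; lia
        right_inv r := by
          have := r.2
          ext
          dsimp only
          lia }
    exact (e.tsum_eq fun r : {r : ℤ // r ≤ k - 1} => f r.1).symm
  rw [e, ← (Equiv.addRight k).hasSum_iff]
  exact HasSum.of_nat_of_neg_add_one (f := f ∘ Equiv.addRight k) h₁ h₂.hasSum

/-- For every integer `ν`, the integral of `ρ_t` over the ball `{‖x‖ ≤ p^ν}` equals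
`e^{−σtp^{−νb}} + Σ_{r ≤ −ν−1} p^{ν+r} (e^{−σtp^{rb}} − e^{−σtp^{(r+1)b}})`. -/
theorem stmt_4 (p : ℕ) [Fact p.Prime]
    [MeasurableSpace ℚ_[p]] [BorelSpace ℚ_[p]]
    (μ : Measure ℚ_[p]) [μ.IsAddHaarMeasure]
    (hμ : μ {x : ℚ_[p] | ‖x‖ ≤ 1} = 1)
    (b σ t : ℝ) (hb : 0 < b) (hσ : 0 < σ) (ht : 0 < t) (ν : ℤ) :
    ∫ x in {x : ℚ_[p] | ‖x‖ ≤ (p : ℝ) ^ ν}, rho p b σ t x ∂μ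
      = Real.exp (-(σ * t * (p : ℝ) ^ (-(ν : ℝ) * b))) +
        ∑' r : {r : ℤ // r ≤ -ν - 1},
          (p : ℝ) ^ (ν + r.1) *
            (Real.exp (-(σ * t * (p : ℝ) ^ ((r.1 : ℝ) * b))) -
              Real.exp (-(σ * t * (p : ℝ) ^ (((r.1 : ℝ) + 1) * b)))) := by
  have hp0 : (0 : ℝ) < p := by exact_mod_cast (Fact.out : p.Prime).pos
  have hp1 : (1 : ℝ) < p := by exact_mod_cast (Fact.out : p.Prime).one_lt
  set g : ℝ → ℝ := fun r => Real.exp (-(σ * t * (p : ℝ) ^ (r * b))) with hg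
  have g_anti : Antitone g := antitone_exp_neg_mul_rpow (by positivity) hp1.le hb.le
  have g_tendsto := tendsto_exp_neg_mul_rpow (b := b) (mul_pos hσ ht) hp1 hb
  have g_diff_nonneg (r : ℝ) : 0 ≤ g r - g (r + 1) := sub_nonneg.2 (g_anti (by linarith))
  have g_diff_le_one (r : ℝ) : g r - g (r + 1) ≤ 1 := by
    have h1 : g r ≤ 1 := Real.exp_le_one_iff.2 (neg_nonpos.2 (by positivity))
    have h2 : 0 < g (r + 1) := Real.exp_pos _
    linarith
  let F : ℤ → ℚ_[p] → ℝ := fun r x => (g r - g (r + 1)) * ((p : ℝ) ^ r *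
    Set.indicator {y : ℚ_[p] | ‖y‖ ≤ (p : ℝ) ^ (-r)} (fun _ => (1 : ℝ)) x)
  let w : ℤ → ℝ := fun r => (p : ℝ) ^ (min (ν + r) 0) * (g r - g (r + 1))
  have hball (n : ℤ) : μ {x : ℚ_[p] | ‖x‖ ≤ (p : ℝ) ^ n} ≠ ⊤ := by
    intro h
    have := padic_measure_closedBall_zpow p μ hμ n
    rw [Measure.real, h, ENNReal.toReal_top] at this
    exact (zpow_pos hp0 n).ne this
  have F_nonneg (r : ℤ) (x : ℚ_[p]) : 0 ≤ F r x :=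
    mul_nonneg (g_diff_nonneg _) (mul_nonneg (by positivity)
      (Set.indicator_nonneg (fun _ _ => zero_le_one) _))
  have F_int (r : ℤ) : Integrable (F r) (μ.restrict {x : ℚ_[p] | ‖x‖ ≤ (p : ℝ) ^ ν}) := by
    refine Integrable.const_mul (Integrable.const_mul ?_ _) _
    refine Integrable.restrict ?_
    rw [integrable_indicator_iff (padic_measurableSet_closedBall p _)]
    exact integrableOn_const (hball _)
  have F_integral (r : ℤ) : ∫ x in {x : ℚ_[p] | ‖x‖ ≤ (p : ℝ) ^ ν}, F r x ∂μ = w r := by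
    simp only [F, w]
    rw [integral_const_mul, integral_const_mul,
      integral_indicator (padic_measurableSet_closedBall p _),
      Measure.restrict_restrict (padic_measurableSet_closedBall p _), setIntegral_const]
    have hinter : {y : ℚ_[p] | ‖y‖ ≤ (p : ℝ) ^ (-r)} ∩ {x : ℚ_[p] | ‖x‖ ≤ (p : ℝ) ^ ν} =
        {x : ℚ_[p] | ‖x‖ ≤ (p : ℝ) ^ (min (-r) ν)} := by
      ext x
      simp [(zpow_right_mono₀ hp1.le).map_min]
    rw [hinter, padic_measure_closedBall_zpow p μ hμ, smul_eq_mul, mul_one,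
      ← zpow_add₀ hp0.ne', mul_comm]
    congr 2
    lia
  have w_hasSum : HasSum w (g (-(ν : ℝ)) + ∑' r : {r : ℤ // r ≤ -ν - 1}, w r.1) := by
    refine hasSum_int_split (-ν) ?_ ?_
    · have hw (n : ℕ) : w (n + -ν) = g (n + -ν) - g ((n + 1 : ℕ) + -ν) := by
        have : min (ν + (n + -ν)) 0 = (0 : ℤ) := by lia
        simp only [w, this]
        push_cast
        rw [zpow_zero, one_mul, add_right_comm]
      simp only [hw]
      rw [hasSum_iff_tendsto_nat_of_nonneg]
      · simp only [Finset.sum_range_sub' fun n : ℕ => g (n + -ν)]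
        have := (g_tendsto.comp (Filter.tendsto_atTop_add_const_right _ (-(ν : ℝ))
          tendsto_natCast_atTop_atTop)).const_sub (g (-(ν : ℝ)))
        simpa using this
      · intro n
        exact sub_nonneg.2 (g_anti (by push_cast; linarith))
    · refine Summable.of_nonneg_of_le
        (fun n => mul_nonneg (by positivity) (g_diff_nonneg _)) (fun n => ?_)
        (summable_geometric_of_lt_one (inv_nonneg.2 hp0.le) (inv_lt_one_of_one_lt₀ hp1))
      have hmin : min (ν + (-((n : ℤ) + 1) + -ν)) 0 ≤ -(n : ℤ) := by lia
      calc _ ≤ (p : ℝ) ^ (-(n : ℤ)) * 1 :=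
            mul_le_mul (zpow_le_zpow_right₀ hp1.le hmin) (g_diff_le_one _)
              (g_diff_nonneg _) (by positivity)
        _ = _ := by simp
  have key := hasSum_integral_of_summable_integral_norm F_int (by
    simp only [Real.norm_of_nonneg (F_nonneg _ _), F_integral]
    exact w_hasSum.summable)
  simp only [F_integral] at key
  have hrho : ∫ x in {x : ℚ_[p] | ‖x‖ ≤ (p : ℝ) ^ ν}, rho p b σ t x ∂μ =
      g (-(ν : ℝ)) + ∑' r : {r : ℤ // r ≤ -ν - 1}, w r.1 := key.unique w_hasSum
  rw [hrho]
  congr 1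
  refine tsum_congr fun r => ?_
  have hr := r.2
  simp only [w, min_eq_left (show ν + r.1 ≤ 0 by lia), hg]
end

section
/- For every integer ν, the integral of ρ_t over the ball {x ∈ ℚ_p : ‖x‖ ≤ p^ν} is at least e^{−σ t p^{−ν b}}; in particular, ∫_{ℤ_p} ρ_t(x) dμ(x) ≥ e^{−σ t}. -/
open MeasureTheory ENNReal

open Metric Filter Topology

namespace Padic

variable {p : ℕ} [Fact p.Prime]

lemma closedBall_zpow_add_one_eq_biUnion (n : ℤ) :
    closedBall (0 : ℚ_[p]) ((p : ℝ) ^ (n + 1)) =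
      ⋃ i ∈ Finset.range p, closedBall ((i : ℚ_[p]) * (p : ℚ_[p]) ^ (-(n + 1))) ((p : ℝ) ^ n) := by
  have hp : (p : ℚ_[p]) ≠ 0 := by exact_mod_cast (Fact.out : p.Prime).ne_zero
  have hp0 : (0 : ℝ) < p := by exact_mod_cast (Fact.out : p.Prime).pos
  have hc : ‖(p : ℚ_[p]) ^ (-(n + 1))‖ = (p : ℝ) ^ (n + 1) := by
    rw [Padic.norm_p_zpow, neg_neg]
  ext x
  simp only [Set.mem_iUnion, mem_closedBall, dist_eq_norm, sub_zero, Finset.mem_range,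
    exists_prop]
  constructor
  · intro hx
    have hy : ‖x * (p : ℚ_[p]) ^ (n + 1)‖ ≤ 1 := by
      rw [norm_mul, Padic.norm_p_zpow, zpow_neg]
      exact mul_inv_le_one_of_le₀ hx (zpow_pos hp0 _).le
    let y : ℤ_[p] := ⟨x * (p : ℚ_[p]) ^ (n + 1), hy⟩
    refine ⟨y.zmodRepr, y.zmodRepr_lt_p, ?_⟩
    have hlt : ‖x * (p : ℚ_[p]) ^ (n + 1) - (y.zmodRepr : ℚ_[p])‖ < 1 := by
      have := y.norm_sub_zmodRepr_lt_one
      rwa [PadicInt.norm_def, PadicInt.coe_sub, PadicInt.coe_natCast] at this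
    have hxy : x - (y.zmodRepr : ℚ_[p]) * (p : ℚ_[p]) ^ (-(n + 1)) =
        (x * (p : ℚ_[p]) ^ (n + 1) - (y.zmodRepr : ℚ_[p])) * (p : ℚ_[p]) ^ (-(n + 1)) := by
      rw [sub_mul, mul_assoc, ← zpow_add₀ hp, add_neg_cancel, zpow_zero, mul_one]
    rw [Padic.norm_le_pow_iff_norm_lt_pow_add_one, hxy, norm_mul, hc]
    exact mul_lt_of_lt_one_left (zpow_pos hp0 _) hlt
  · rintro ⟨i, -, hx⟩
    have hi : ‖(i : ℚ_[p]) * (p : ℚ_[p]) ^ (-(n + 1))‖ ≤ (p : ℝ) ^ (n + 1) := by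
      rw [norm_mul, hc]
      have : ‖(i : ℚ_[p])‖ ≤ 1 := by exact_mod_cast Padic.norm_int_le_one (p := p) (i : ℤ)
      exact mul_le_of_le_one_left (zpow_pos hp0 _).le this
    have hx' : ‖x - (i : ℚ_[p]) * (p : ℚ_[p]) ^ (-(n + 1))‖ ≤ (p : ℝ) ^ (n + 1) :=
      ((Padic.norm_le_pow_iff_norm_lt_pow_add_one _ _).1 hx).le
    have := Padic.nonarchimedean (x - (i : ℚ_[p]) * (p : ℚ_[p]) ^ (-(n + 1)))
      ((i : ℚ_[p]) * (p : ℚ_[p]) ^ (-(n + 1)))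
    rw [sub_add_cancel] at this
    exact this.trans (max_le hx' hi)

lemma pairwiseDisjoint_closedBall_natCast_mul (n : ℤ) :
    (Finset.range p : Set ℕ).PairwiseDisjoint
      fun i ↦ closedBall ((i : ℚ_[p]) * (p : ℚ_[p]) ^ (-(n + 1))) ((p : ℝ) ^ n) := by
  have hp0 : (0 : ℝ) < p := by exact_mod_cast (Fact.out : p.Prime).pos
  intro i hi j hj hij
  refine Set.disjoint_left.2 fun x hxi hxj ↦ hij ?_
  rw [mem_closedBall, dist_eq_norm] at hxi hxj
  have h : ‖((i : ℚ_[p]) - j) * (p : ℚ_[p]) ^ (-(n + 1))‖ ≤ (p : ℝ) ^ n := by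
    have := Padic.nonarchimedean (x - (j : ℚ_[p]) * (p : ℚ_[p]) ^ (-(n + 1)))
      (-(x - (i : ℚ_[p]) * (p : ℚ_[p]) ^ (-(n + 1))))
    rw [norm_neg] at this
    rw [show ((i : ℚ_[p]) - j) * (p : ℚ_[p]) ^ (-(n + 1)) =
      x - (j : ℚ_[p]) * (p : ℚ_[p]) ^ (-(n + 1)) +
        -(x - (i : ℚ_[p]) * (p : ℚ_[p]) ^ (-(n + 1))) by ring]
    exact this.trans (max_le hxj hxi)
  rw [Padic.norm_le_pow_iff_norm_lt_pow_add_one, norm_mul, Padic.norm_p_zpow, neg_neg] at h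
  have h1 : ‖(((i : ℤ) - j : ℤ) : ℚ_[p])‖ < 1 := by
    push_cast
    by_contra! hge
    exact h.not_ge (le_mul_of_one_le_left (zpow_pos hp0 _).le hge)
  rw [Padic.norm_intCast_lt_one_iff] at h1
  have hmod : j ≡ i [MOD p] := (Nat.modEq_iff_dvd).2 h1
  exact (hmod.eq_of_lt_of_lt (by simpa using hj) (by simpa using hi)).symm

variable [MeasurableSpace ℚ_[p]] [BorelSpace ℚ_[p]] (μ : Measure ℚ_[p]) [μ.IsAddHaarMeasure]

lemma measureReal_closedBall_zpow_add_one (n : ℤ) :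
    μ.real (closedBall 0 ((p : ℝ) ^ (n + 1))) = p * μ.real (closedBall 0 ((p : ℝ) ^ n)) := by
  have htrans (a : ℚ_[p]) (r : ℝ) : μ (closedBall a r) = μ (closedBall 0 r) := by
    rw [← measure_preimage_add μ a (closedBall a r), preimage_add_closedBall, sub_self]
  rw [Measure.real, closedBall_zpow_add_one_eq_biUnion,
    measure_biUnion_finset (pairwiseDisjoint_closedBall_natCast_mul n)
      fun _ _ ↦ measurableSet_closedBall]
  simp [htrans, Measure.real]

lemma measureReal_closedBall_zpow (hμ : μ.real (closedBall 0 1) = 1) (n : ℤ) :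
    μ.real (closedBall 0 ((p : ℝ) ^ n)) = (p : ℝ) ^ n := by
  have hp0 : (p : ℝ) ≠ 0 := by exact_mod_cast (Fact.out : p.Prime).ne_zero
  induction n with
  | zero => simpa using hμ
  | succ n ih => rw [measureReal_closedBall_zpow_add_one, ih, zpow_add_one₀ hp0, mul_comm]
  | pred n ih =>
    rw [← sub_add_cancel (-(n : ℤ)) 1, measureReal_closedBall_zpow_add_one, sub_add_cancel] at ih
    refine mul_left_cancel₀ hp0 (ih.trans ?_)
    rw [← zpow_one_add₀ hp0, add_sub_cancel]

end Padic

lemma summable_int_sub_of_antitone {f : ℤ → ℝ} (hf : Antitone f) (h0 : ∀ r, 0 ≤ f r) {C : ℝ}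
    (hC : ∀ r, f r ≤ C) : Summable fun r ↦ f r - f (r + 1) := by
  have hnn (r : ℤ) : 0 ≤ f r - f (r + 1) := sub_nonneg.2 (hf (by simp))
  refine Summable.of_nat_of_neg_add_one ?_ ?_
  · refine summable_of_sum_range_le (c := C) (fun n ↦ hnn n) fun n ↦ ?_
    have := Finset.sum_range_sub' (fun k : ℕ ↦ f k) n
    push_cast at this
    rw [this]
    linarith [h0 n, hC 0]
  · refine summable_of_sum_range_le (c := C) (fun n ↦ hnn _) fun n ↦ ?_
    have := Finset.sum_range_sub (fun k : ℕ ↦ f (-k)) n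
    push_cast at this
    have e (k : ℕ) : -((k : ℤ) + 1) + 1 = -k := by ring
    simp only [e, this, neg_zero]
    linarith [h0 0, hC (-n)]

/-- The eigenvalue `exp (-σ t p^{rb})` of the `p`-adic heat semigroup. -/
noncomputable def heatMultiplier (p : ℕ) (b σ t : ℝ) (r : ℤ) : ℝ :=
  Real.exp (-(σ * t * (p : ℝ) ^ ((r : ℝ) * b)))

lemma heatMultiplier_le_one {p : ℕ} {b σ t : ℝ} (hσ : 0 < σ) (ht : 0 < t) (r : ℤ) :
    heatMultiplier p b σ t r ≤ 1 :=
  Real.exp_le_one_iff.2 (by rw [neg_nonpos]; positivity)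

section heatMultiplier

variable {p : ℕ} [Fact p.Prime] {b σ t : ℝ}

lemma antitone_heatMultiplier (hb : 0 < b) (hσ : 0 < σ) (ht : 0 < t) :
    Antitone (heatMultiplier p b σ t) := by
  intro r s hrs
  have hp1 : (1 : ℝ) ≤ p := by exact_mod_cast (Fact.out : p.Prime).one_lt.le
  have hrs' : (r : ℝ) ≤ s := by exact_mod_cast hrs
  unfold heatMultiplier
  gcongr

lemma tendsto_heatMultiplier (hb : 0 < b) (hσ : 0 < σ) (ht : 0 < t) :
    Tendsto (heatMultiplier p b σ t) atTop (𝓝 0) := by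
  have hp1 : (1 : ℝ) < p := by exact_mod_cast (Fact.out : p.Prime).one_lt
  refine Real.tendsto_exp_neg_atTop_nhds_zero.comp ?_
  refine Tendsto.const_mul_atTop (mul_pos hσ ht) ?_
  exact (tendsto_rpow_atTop_of_base_gt_one _ hp1).comp
    (tendsto_intCast_atTop_atTop.atTop_mul_const hb)

theorem heatMultiplier_le_setIntegral_rho [MeasurableSpace ℚ_[p]] [BorelSpace ℚ_[p]]
    (μ : Measure ℚ_[p]) [μ.IsAddHaarMeasure] (hμ : μ.real (closedBall 0 1) = 1)
    (hb : 0 < b) (hσ : 0 < σ) (ht : 0 < t) (ν : ℤ) :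
    heatMultiplier p b σ t (-ν) ≤ ∫ x in closedBall 0 ((p : ℝ) ^ ν), rho p b σ t x ∂μ := by
  set f := heatMultiplier p b σ t
  have hp1 : (1 : ℝ) ≤ p := by exact_mod_cast (Fact.out : p.Prime).one_lt.le
  have hp0 : (0 : ℝ) < p := by linarith
  have hf : Antitone f := antitone_heatMultiplier hb hσ ht
  have hnn (r : ℤ) : 0 ≤ f r - f (r + 1) := sub_nonneg.2 (hf (by simp))
  let F (r : ℤ) (x : ℚ_[p]) : ℝ := (f r - f (r + 1)) *
    ((p : ℝ) ^ r * (closedBall (0 : ℚ_[p]) ((p : ℝ) ^ (-r))).indicator (fun _ ↦ 1) x)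
  have hF_nonneg (r : ℤ) (x : ℚ_[p]) : 0 ≤ F r x :=
    mul_nonneg (hnn r) (mul_nonneg (zpow_pos hp0 _).le
      (Set.indicator_nonneg (fun _ _ ↦ zero_le_one) _))
  have hrho : rho p b σ t = fun x ↦ ∑' r, F r x := by
    ext x
    refine tsum_congr fun r ↦ ?_
    have : {y : ℚ_[p] | ‖y‖ ≤ (p : ℝ) ^ (-r)} = closedBall 0 ((p : ℝ) ^ (-r)) := by
      ext; simp
    simp only [F, f, heatMultiplier, this, Int.cast_add, Int.cast_one]
  have hFint (r : ℤ) : Integrable (F r) μ :=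
    (((integrable_indicator_iff measurableSet_closedBall).2
      (integrableOn_const (isCompact_closedBall _ _).measure_ne_top)).const_mul _).const_mul _
  have hFtotal (r : ℤ) : ∫ x, F r x ∂μ = f r - f (r + 1) := by
    simp only [F, integral_const_mul]
    rw [integral_indicator_const _ measurableSet_closedBall,
      Padic.measureReal_closedBall_zpow μ hμ, smul_eq_mul, mul_one, ← zpow_add₀ hp0.ne']
    simp
  have hle (r : ℤ) : ∫ x in closedBall 0 ((p : ℝ) ^ ν), F r x ∂μ ≤ f r - f (r + 1) :=
    (setIntegral_le_integral (hFint r) (ae_of_all _ (hF_nonneg r))).trans_eq (hFtotal r)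
  have heq (r : ℤ) (hr : -ν ≤ r) :
      ∫ x in closedBall 0 ((p : ℝ) ^ ν), F r x ∂μ = f r - f (r + 1) := by
    rw [← hFtotal r]
    refine setIntegral_eq_integral_of_forall_compl_eq_zero fun x hx ↦ ?_
    have hx' : x ∉ closedBall (0 : ℚ_[p]) ((p : ℝ) ^ (-r)) := fun h ↦
      hx (closedBall_subset_closedBall (zpow_le_zpow_right₀ hp1 (by lia)) h)
    simp only [F, Set.indicator_of_notMem hx', mul_zero]
  have hnorm : Summable fun r ↦ ∫ x in closedBall 0 ((p : ℝ) ^ ν), ‖F r x‖ ∂μ := by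
    simp_rw [fun r x ↦ Real.norm_of_nonneg (hF_nonneg r x)]
    exact Summable.of_nonneg_of_le (fun r ↦ integral_nonneg (hF_nonneg r)) hle
      (summable_int_sub_of_antitone hf (fun r ↦ (Real.exp_pos _).le)
        (heatMultiplier_le_one hσ ht))
  have hsum := hasSum_integral_of_summable_integral_norm
    (fun r ↦ (hFint r).integrableOn) hnorm
  rw [hrho]
  have hlim : Tendsto (fun n : ℕ ↦ f (-ν) - f (-ν + n)) atTop (𝓝 (f (-ν) - 0)) :=
    ((tendsto_heatMultiplier hb hσ ht).comp
      (tendsto_atTop_add_const_left _ _ tendsto_natCast_atTop_atTop)).const_sub _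
  rw [sub_zero] at hlim
  refine le_of_tendsto' hlim fun n ↦ ?_
  have htel := Finset.sum_range_sub' (fun k : ℕ ↦ f (-ν + k)) n
  simp only [Nat.cast_zero, add_zero] at htel
  rw [← htel]
  refine le_trans (le_of_eq ?_) (sum_le_hasSum
    ((Finset.range n).image fun k : ℕ ↦ -ν + (k : ℤ))
    (fun r _ ↦ integral_nonneg (hF_nonneg r)) hsum)
  rw [Finset.sum_image fun a _ b _ h ↦ by simpa using h]
  refine Finset.sum_congr rfl fun k _ ↦ ?_
  rw [heq _ (by lia)]
  push_cast
  rw [add_assoc]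

end heatMultiplier

/-- For every integer `ν`, the integral of `ρ_t` over the ball `{‖x‖ ≤ p^ν}` is at least
`e^{−σtp^{−νb}}`; in particular, `∫_{ℤ_p} ρ_t dμ ≥ e^{−σt}`. -/
theorem stmt_6 (p : ℕ) [Fact p.Prime]
    [MeasurableSpace ℚ_[p]] [BorelSpace ℚ_[p]]
    (μ : Measure ℚ_[p]) [μ.IsAddHaarMeasure]
    (hμ : μ {x : ℚ_[p] | ‖x‖ ≤ 1} = 1)
    (b σ t : ℝ) (hb : 0 < b) (hσ : 0 < σ) (ht : 0 < t) :
    (∀ ν : ℤ,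
      Real.exp (-(σ * t * (p : ℝ) ^ (-(ν : ℝ) * b)))
        ≤ ∫ x in {x : ℚ_[p] | ‖x‖ ≤ (p : ℝ) ^ ν}, rho p b σ t x ∂μ) ∧
    Real.exp (-(σ * t)) ≤ ∫ x in {x : ℚ_[p] | ‖x‖ ≤ 1}, rho p b σ t x ∂μ := by
  have hball (R : ℝ) : {x : ℚ_[p] | ‖x‖ ≤ R} = closedBall 0 R := by
    ext; simp
  rw [hball] at hμ
  have hμ' : μ.real (closedBall 0 1) = 1 := by simp [Measure.real, hμ]
  have h (ν : ℤ) := heatMultiplier_le_setIntegral_rho μ hμ' hb hσ ht ν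
  refine ⟨fun ν ↦ ?_, ?_⟩
  · simpa [heatMultiplier, hball] using h ν
  · simpa [heatMultiplier, hball] using h 0
end

section
/- For every natural number k, P(N = k) = (e^{−T β} / k!) · Σ ∏_{j=1}^{k} (e^{T β_{i_j}} − 1), where the sum runs over all k-tuples (i_1, …, i_k) of pairwise distinct natural numbers (this sum converges since β < ∞). -/
open MeasureTheory ProbabilityTheory ENNReal

/-- Pairs of a `k`-element finset and an enumeration of it correspond to injective `k`-tuples. -/
noncomputable def sigmaEquivInjective (α : Type*) (k : ℕ) :
    (Σ S : {S : Finset α // S.card = k}, Fin k ≃ S.1) ≃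
      {v : Fin k → α // Function.Injective v} := by
  refine Equiv.ofBijective
    (fun p => ⟨fun j => (p.2 j : α), Subtype.val_injective.comp p.2.injective⟩) ⟨?_, ?_⟩
  · rintro ⟨⟨S, hS⟩, e⟩ ⟨⟨S', hS'⟩, e'⟩ h
    have h1 : ∀ j, (e j : α) = e' j := fun j => congrFun (congrArg Subtype.val h) j
    obtain rfl : S = S' := by
      ext x
      constructor
      · intro hx
        have := h1 (e.symm ⟨x, hx⟩)
        rw [Equiv.apply_symm_apply] at this
        change x = _ at this
        exact this ▸ (e' _).2
      · intro hx
        have := h1 (e'.symm ⟨x, hx⟩)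
        rw [Equiv.apply_symm_apply] at this
        change _ = x at this
        exact this ▸ (e _).2
    obtain rfl : e = e' := Equiv.ext fun j => Subtype.ext (h1 j)
    rfl
  · rintro ⟨v, hv⟩
    refine ⟨⟨⟨Finset.univ.map ⟨v, hv⟩, by simp⟩,
      Equiv.ofBijective (fun j => ⟨v j, by simp⟩) ⟨?_, ?_⟩⟩, rfl⟩
    · exact fun i j h => hv (congrArg Subtype.val h)
    · rintro ⟨x, hx⟩
      obtain ⟨j, -, rfl⟩ := Finset.mem_map.1 hx
      exact ⟨j, rfl⟩

theorem tsum_injective_prod_eq {α : Type*} (k : ℕ) (a : α → ℝ≥0∞) :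
    ∑' v : {v : Fin k → α // Function.Injective v}, ∏ j, a (v.1 j)
      = (Nat.factorial k) * ∑' S : {S : Finset α // S.card = k}, ∏ i ∈ S.1, a i := by
  classical
  rw [← (sigmaEquivInjective α k).tsum_eq, ENNReal.tsum_sigma', ← ENNReal.tsum_mul_left]
  refine tsum_congr fun S => ?_
  have h (e : Fin k ≃ S.1) :
      ∏ j, a ((sigmaEquivInjective α k ⟨S, e⟩).1 j) = ∏ i ∈ S.1, a i := by
    rw [← Finset.prod_coe_sort S.1 a, ← e.prod_comp]
    rfl
  rw [tsum_congr h, tsum_fintype, Finset.sum_const, Finset.card_univ,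
    Fintype.card_equiv (Fintype.equivOfCardEq (by simp [S.2])), Fintype.card_fin, nsmul_eq_mul]

/-- The event that `S` is exactly the set of indices of the failing events. -/
def failExactly {Ω ι : Type*} (A : ι → Set Ω) (S : Finset ι) : Set Ω :=
  {ω | ∀ i, ω ∉ A i ↔ i ∈ S}

theorem failExactly_eq_iInter {Ω ι : Type*} [DecidableEq ι] (A : ι → Set Ω) (S : Finset ι) :
    failExactly A S = ⋂ i, if i ∈ S then (A i)ᶜ else A i := by
  ext ω
  simp only [failExactly, Set.mem_ofPred_eq, Set.mem_iInter]
  refine forall_congr' fun i => ?_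
  by_cases h : i ∈ S <;> simp [h]

theorem measurableSet_failExactly {Ω ι : Type*} [MeasurableSpace Ω] [Countable ι]
    {A : ι → Set Ω} (hA : ∀ i, MeasurableSet (A i)) (S : Finset ι) :
    MeasurableSet (failExactly A S) := by
  classical
  rw [failExactly_eq_iInter]
  refine MeasurableSet.iInter fun i => ?_
  split_ifs
  exacts [(hA i).compl, hA i]

theorem setOf_tsum_indicator_compl_eq {Ω ι : Type*} (A : ι → Set Ω) (k : ℕ) :
    {ω | ∑' i, ((A i)ᶜ).indicator (fun _ => (1 : ℝ≥0∞)) ω = k}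
      = ⋃ S : {S : Finset ι // S.card = k}, failExactly A S.1 := by
  ext ω
  have h : ∑' i, ((A i)ᶜ).indicator (fun _ => (1 : ℝ≥0∞)) ω
      = ({i | ω ∉ A i}.encard : ℝ≥0∞) := by
    rw [← ENNReal.tsum_set_one, tsum_subtype {i | ω ∉ A i} fun _ => (1 : ℝ≥0∞)]
    rfl
  simp only [Set.mem_ofPred_eq, h, Set.mem_iUnion, failExactly]
  constructor
  · intro hk
    have hk' : {i | ω ∉ A i}.encard = k := by exact_mod_cast hk
    have hfin := Set.finite_of_encard_eq_coe hk'
    refine ⟨⟨hfin.toFinset, ?_⟩, by simp⟩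
    rw [hfin.encard_eq_coe_toFinset_card] at hk'
    exact_mod_cast hk'
  · rintro ⟨⟨S, rfl⟩, hS⟩
    have : {i | ω ∉ A i} = (S : Set ι) := Set.ext hS
    rw [this, Set.encard_coe_eq_coe_finsetCard]
    simp

theorem pairwise_disjoint_failExactly {Ω ι : Type*} (A : ι → Set Ω) :
    Pairwise (Function.onFun Disjoint (failExactly A)) := by
  intro S S' hne
  refine Set.disjoint_left.2 fun ω h h' => hne ?_
  ext i
  exact (h i).symm.trans (h' i)

theorem measure_failExactly {Ω : Type*} [MeasurableSpace Ω] {P : Measure Ω}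
    [IsProbabilityMeasure P] {b : ℕ → ℝ} (hsum : Summable b)
    {A : ℕ → Set Ω} (hA : ∀ i, MeasurableSet (A i)) (hind : iIndepSet A P)
    (hprob : ∀ i, P (A i) = ENNReal.ofReal (Real.exp (-b i))) (S : Finset ℕ) :
    P (failExactly A S) = ENNReal.ofReal (Real.exp (-∑' i, b i)) *
      ∏ i ∈ S, ENNReal.ofReal (Real.exp (b i) - 1) := by
  set B : ℕ → Set Ω := fun i => if i ∈ S then (A i)ᶜ else A i with hB
  have hBm (i : ℕ) : MeasurableSet (B i) := by
    simp only [hB]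
    split_ifs
    exacts [(hA i).compl, hA i]
  have hPB (i : ℕ) : P (B i) = ENNReal.ofReal (Real.exp (-b i)) *
      if i ∈ S then ENNReal.ofReal (Real.exp (b i) - 1) else 1 := by
    simp only [hB]
    split_ifs
    · rw [prob_compl_eq_one_sub (hA i), hprob, ← ENNReal.ofReal_mul (Real.exp_pos _).le,
        mul_sub, ← Real.exp_add, neg_add_cancel, Real.exp_zero, mul_one,
        ENNReal.ofReal_sub _ (Real.exp_pos _).le, ENNReal.ofReal_one]
    · rw [hprob, mul_one]
  have hfin (s : Finset ℕ) : P (⋂ i ∈ s, B i) = ∏ i ∈ s, P (B i) := by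
    refine (iIndep_iff _ _).1 hind s fun i _ => ?_
    have : MeasurableSet[MeasurableSpace.generateFrom {A i}] (A i) :=
      MeasurableSpace.measurableSet_generateFrom rfl
    simp only [hB]
    split_ifs
    exacts [this.compl, this]
  have hlim : Filter.Tendsto (fun n => P (⋂ i ∈ Finset.range n, B i)) Filter.atTop
      (nhds (P (⋂ n, ⋂ i ∈ Finset.range n, B i))) := by
    refine tendsto_measure_iInter_atTop
      (fun n => (Finset.measurableSet_biInter _ fun i _ => hBm i).nullMeasurableSet) ?_
      ⟨0, measure_ne_top _ _⟩
    intro m n hmn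
    exact Set.biInter_subset_biInter_left (Finset.range_mono hmn)
  have hset : ⋂ n, ⋂ i ∈ Finset.range n, B i = failExactly A S := by
    rw [failExactly_eq_iInter]
    ext ω
    simp only [Set.mem_iInter, Finset.mem_range]
    exact ⟨fun h i => h (i + 1) i i.lt_succ_self, fun h _ i _ => h i⟩
  rw [hset] at hlim
  refine tendsto_nhds_unique hlim ?_
  have hexp : Filter.Tendsto (fun n => ENNReal.ofReal (Real.exp (-∑ i ∈ Finset.range n, b i)) *
      ∏ i ∈ S, ENNReal.ofReal (Real.exp (b i) - 1)) Filter.atTop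
      (nhds (ENNReal.ofReal (Real.exp (-∑' i, b i)) *
        ∏ i ∈ S, ENNReal.ofReal (Real.exp (b i) - 1))) := by
    refine ENNReal.Tendsto.mul_const (ENNReal.tendsto_ofReal
      ((Real.continuous_exp.tendsto _).comp hsum.hasSum.tendsto_sum_nat.neg)) (Or.inr ?_)
    exact ENNReal.prod_ne_top fun i _ => ENNReal.ofReal_ne_top
  refine hexp.congr' ?_
  obtain ⟨m, hm⟩ := S.exists_nat_subset_range
  filter_upwards [Filter.eventually_ge_atTop m] with n hn
  rw [hfin, Finset.prod_congr rfl fun i _ => hPB i, Finset.prod_mul_distrib,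
    Finset.prod_ite_mem, Finset.inter_eq_right.2 (hm.trans (Finset.range_mono hn)),
    ← ENNReal.ofReal_prod_of_nonneg fun i _ => (Real.exp_pos _).le, ← Real.exp_sum,
    Finset.sum_neg_distrib]

/-- For the counting variable `N = Σ_i 1_{Ω \ A_i}` of failed events among independent
events `A_i` with `P(A_i) = e^{−Tβ_i}` and `β = Σ β_i < ∞`: for every `k`,
`P(N = k) = (e^{−Tβ}/k!) · Σ ∏_{j=1}^k (e^{Tβ_{i_j}} − 1)`, the sum running over all
`k`-tuples of pairwise distinct natural numbers. -/
theorem stmt_13 {Ω : Type*} [MeasurableSpace Ω] (P : Measure Ω) [IsProbabilityMeasure P]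
    (T : ℝ) (hT : 0 < T) (β : ℕ → ℝ) (hβ : ∀ i, 0 < β i) (hsum : Summable β)
    (A : ℕ → Set Ω) (hA : ∀ i, MeasurableSet (A i)) (hind : iIndepSet A P)
    (hprob : ∀ i, P (A i) = ENNReal.ofReal (Real.exp (-(T * β i))))
    (N : Ω → ℝ≥0∞)
    (hN : ∀ ω, N ω = ∑' i, ((A i)ᶜ).indicator (fun _ => (1 : ℝ≥0∞)) ω) (k : ℕ) :
    P {ω | N ω = (k : ℝ≥0∞)}
      = ENNReal.ofReal
          (Real.exp (-(T * ∑' i, β i)) / (Nat.factorial k) *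
            ∑' v : {v : Fin k → ℕ // Function.Injective v},
              ∏ j : Fin k, (Real.exp (T * β (v.1 j)) - 1)) := by
  have ha (i : ℕ) : 0 ≤ Real.exp (T * β i) - 1 :=
    sub_nonneg.2 (Real.one_le_exp (mul_pos hT (hβ i)).le)
  set c := Real.exp (-(T * ∑' i, β i)) with hc
  have hcpos : 0 < c := Real.exp_pos _
  set F := ∑' S : {S : Finset ℕ // S.card = k},
    ∏ i ∈ S.1, ENNReal.ofReal (Real.exp (T * β i) - 1) with hF
  have hP : P {ω | N ω = (k : ℝ≥0∞)} = ENNReal.ofReal c * F := by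
    simp only [hN]
    rw [setOf_tsum_indicator_compl_eq, measure_iUnion
      ((pairwise_disjoint_failExactly A).comp_of_injective Subtype.val_injective)
      (fun S : {S : Finset ℕ // S.card = k} => measurableSet_failExactly hA S.1), hF,
      ← ENNReal.tsum_mul_left]
    refine tsum_congr fun S => ?_
    rw [measure_failExactly (hsum.mul_left T) hA hind hprob, tsum_mul_left]
  have hFtop : F ≠ ∞ := by
    intro h
    refine measure_ne_top P {ω | N ω = (k : ℝ≥0∞)} ?_
    rw [hP, h, ENNReal.mul_top (ENNReal.ofReal_pos.2 hcpos).ne']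
  have hreal : ∑' v : {v : Fin k → ℕ // Function.Injective v},
      ∏ j : Fin k, (Real.exp (T * β (v.1 j)) - 1) = Nat.factorial k * F.toReal := by
    have h := congrArg ENNReal.toReal
      (tsum_injective_prod_eq k fun i => ENNReal.ofReal (Real.exp (T * β i) - 1))
    rw [ENNReal.tsum_toReal_eq fun v => ENNReal.prod_ne_top fun _ _ => ENNReal.ofReal_ne_top,
      ENNReal.toReal_mul, ENNReal.toReal_natCast] at h
    simpa only [ENNReal.toReal_prod, ENNReal.toReal_ofReal (ha _)] using h
  have hk : (Nat.factorial k : ℝ) ≠ 0 := by positivity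
  rw [hP, hreal, ← mul_assoc, div_mul_cancel₀ _ hk, ENNReal.ofReal_mul hcpos.le,
    ENNReal.ofReal_toReal hFtop]
end

section
/- For every natural number k ≥ 1, P(N = k) < (e^{T β} / k) · P(N = k − 1). -/
open MeasureTheory ProbabilityTheory ENNReal

/-- The number of events of the family `A` that fail. -/
noncomputable def failCount {ι Ω : Type*} (A : ι → Set Ω) (ω : Ω) : ℝ≥0∞ :=
  ∑' i, ((A i)ᶜ).indicator (fun _ => (1 : ℝ≥0∞)) ω

lemma measurable_failCount {ι Ω : Type*} [Countable ι] [MeasurableSpace Ω] {A : ι → Set Ω}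
    (hA : ∀ i, MeasurableSet (A i)) : Measurable (failCount A) :=
  Measurable.tsum fun i => measurable_const.indicator (hA i).compl

lemma measurableSet_failCount_eq {ι Ω : Type*} [Countable ι] [MeasurableSpace Ω]
    {A : ι → Set Ω} (hA : ∀ i, MeasurableSet (A i)) (c : ℝ≥0∞) :
    MeasurableSet {ω | failCount A ω = c} :=
  measurable_failCount hA (measurableSet_singleton c)

/-- Splitting off the contribution of the index `i` to the count of failed events. -/
lemma failCount_eq_add {ι Ω : Type*} [DecidableEq ι] (A : ι → Set Ω) (i : ι) (ω : Ω) :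
    failCount A ω = ((A i)ᶜ).indicator (fun _ => (1 : ℝ≥0∞)) ω +
      ∑' j, if j = i then 0 else ((A j)ᶜ).indicator (fun _ => (1 : ℝ≥0∞)) ω := by
  rw [failCount, ENNReal.tsum_eq_add_tsum_ite i]
  congr!

/-- The probability that `A i` fails together with exactly `n` other events is the odds of
failure of `A i` times the probability that `A i` holds and exactly `n` events fail. -/
lemma measure_failCount_inter_compl {ι Ω : Type*} [Countable ι] [MeasurableSpace Ω]
    {P : Measure Ω} {A : ι → Set Ω} (hA : ∀ i, MeasurableSet (A i))
    (hind : iIndepSet A P) {x : ι → ℝ} (hx : ∀ i, 0 ≤ x i)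
    (hprob : ∀ i, P (A i) = ENNReal.ofReal (Real.exp (-x i))) (n : ℕ) (i : ι) :
    P ({ω | failCount A ω = (n + 1 : ℕ)} ∩ (A i)ᶜ) =
      ENNReal.ofReal (Real.exp (x i) - 1) * P ({ω | failCount A ω = n} ∩ A i) := by
  classical
  have := hind.isProbabilityMeasure
  set E : Set Ω := {ω | (∑' j, if j = i then 0 else
    ((A j)ᶜ).indicator (fun _ => (1 : ℝ≥0∞)) ω) = n} with hE
  have hfail : {ω | failCount A ω = (n + 1 : ℕ)} ∩ (A i)ᶜ = (A i)ᶜ ∩ E := by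
    ext ω
    simp only [Set.mem_inter_iff, Set.mem_ofPred_eq, hE, and_comm (b := ω ∈ (A i)ᶜ)]
    refine and_congr_right fun hω => ?_
    rw [failCount_eq_add A i, Set.indicator_of_mem hω, Nat.cast_add, Nat.cast_one,
      add_comm (n : ℝ≥0∞)]
    exact ENNReal.add_right_inj ENNReal.one_ne_top
  have hhold : {ω | failCount A ω = n} ∩ A i = A i ∩ E := by
    ext ω
    simp only [Set.mem_inter_iff, Set.mem_ofPred_eq, hE, and_comm (b := ω ∈ A i)]
    refine and_congr_right fun hω => ?_
    rw [failCount_eq_add A i, Set.indicator_of_notMem (by simpa using hω), zero_add]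
  let m : ι → MeasurableSpace Ω := fun j => MeasurableSpace.generateFrom {A j}
  have hmA : ∀ j, MeasurableSet[m j] (A j) := fun j =>
    MeasurableSpace.measurableSet_generateFrom rfl
  have hindep : Indep (⨆ j ∈ ({i} : Set ι), m j) (⨆ j ∈ ({i}ᶜ : Set ι), m j) P :=
    indep_iSup_of_disjoint
      (fun j => MeasurableSpace.generateFrom_le (by rintro _ rfl; exact hA j))
      ((iIndepSet_iff_iIndep _ _).1 hind) disjoint_compl_right
  have hAi : MeasurableSet[⨆ j ∈ ({i} : Set ι), m j] (A i) :=
    (le_iSup₂_of_le i rfl le_rfl : m i ≤ ⨆ j ∈ ({i} : Set ι), m j) _ (hmA i)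
  have hEm : MeasurableSet[⨆ j ∈ ({i}ᶜ : Set ι), m j] E := by
    have hmeas : Measurable[⨆ j ∈ ({i}ᶜ : Set ι), m j] (fun ω => ∑' j, if j = i then 0 else
        ((A j)ᶜ).indicator (fun _ => (1 : ℝ≥0∞)) ω) := by
      refine @Measurable.tsum _ _ _ (_) _ _ _ _ _ _ _ _ _ _ _ _ fun j => ?_
      split_ifs with hj
      · exact measurable_const
      · have hle : m j ≤ ⨆ j ∈ ({i}ᶜ : Set ι), m j :=
          le_iSup₂_of_le j hj le_rfl
        exact Measurable.indicator measurable_const (hle _ (hmA j)).compl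
    exact hmeas (measurableSet_singleton _)
  rw [Indep_iff] at hindep
  rw [hfail, hhold, hindep _ _ hAi.compl hEm, hindep _ _ hAi hEm, prob_compl_eq_one_sub (hA i),
    hprob, ← mul_assoc, ← ENNReal.ofReal_mul (by simpa using hx i), sub_mul, ← Real.exp_add,
    add_neg_cancel, Real.exp_zero, one_mul, ENNReal.ofReal_sub _ (Real.exp_nonneg _),
    ENNReal.ofReal_one]

/-- Double counting: a multiple of `P (N = n)` as a sum over the failing index. -/
lemma natCast_mul_measure_failCount_eq {ι Ω : Type*} [Countable ι] [MeasurableSpace Ω]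
    (P : Measure Ω) {A : ι → Set Ω} (hA : ∀ i, MeasurableSet (A i)) (n : ℕ) :
    (n : ℝ≥0∞) * P {ω | failCount A ω = n} =
      ∑' i, P ({ω | failCount A ω = n} ∩ (A i)ᶜ) := by
  have hS := measurableSet_failCount_eq hA n
  calc (n : ℝ≥0∞) * P {ω | failCount A ω = n}
      = ∫⁻ ω in {ω | failCount A ω = n}, failCount A ω ∂P := by
        rw [setLIntegral_congr_fun hS (fun ω hω => hω), setLIntegral_const]
    _ = ∑' i, ∫⁻ ω in {ω | failCount A ω = n},
          ((A i)ᶜ).indicator (fun _ => (1 : ℝ≥0∞)) ω ∂P :=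
        lintegral_tsum fun i => (measurable_const.indicator (hA i).compl).aemeasurable
    _ = ∑' i, P ({ω | failCount A ω = n} ∩ (A i)ᶜ) := by
        refine tsum_congr fun i => ?_
        rw [lintegral_indicator_const (hA i).compl, one_mul,
          Measure.restrict_apply (hA i).compl, Set.inter_comm]

lemma natCast_succ_mul_measure_failCount_eq {ι Ω : Type*} [Countable ι] [MeasurableSpace Ω]
    {P : Measure Ω} {A : ι → Set Ω} (hA : ∀ i, MeasurableSet (A i))
    (hind : iIndepSet A P) {x : ι → ℝ} (hx : ∀ i, 0 ≤ x i)
    (hprob : ∀ i, P (A i) = ENNReal.ofReal (Real.exp (-x i))) (n : ℕ) :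
    ((n + 1 : ℕ) : ℝ≥0∞) * P {ω | failCount A ω = (n + 1 : ℕ)} =
      ∑' i, ENNReal.ofReal (Real.exp (x i) - 1) * P ({ω | failCount A ω = n} ∩ A i) := by
  rw [natCast_mul_measure_failCount_eq P hA]
  exact tsum_congr (measure_failCount_inter_compl hA hind hx hprob n)

lemma measure_failCount_eq_zero_pos {Ω : Type*} [MeasurableSpace Ω]
    {P : Measure Ω} {A : ℕ → Set Ω} (hA : ∀ i, MeasurableSet (A i))
    (hind : iIndepSet A P) {x : ℕ → ℝ} (hx : ∀ i, 0 ≤ x i) (hsum : Summable x)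
    (hprob : ∀ i, P (A i) = ENNReal.ofReal (Real.exp (-x i))) :
    0 < P {ω | failCount A ω = 0} := by
  have := hind.isProbabilityMeasure
  have hset : {ω | failCount A ω = 0} = ⋂ n : ℕ, ⋂ i ∈ Finset.range n, A i := by
    ext ω
    simp only [failCount, Set.mem_ofPred_eq, ENNReal.tsum_eq_zero, Set.indicator_apply_eq_zero,
      Set.mem_compl_iff, one_ne_zero, imp_false, not_not, Set.mem_iInter, Finset.mem_range]
    exact ⟨fun h _ i _ => h i, fun h i => h (i + 1) i i.lt_succ_self⟩
  have hanti : Antitone fun n : ℕ => ⋂ i ∈ Finset.range n, A i := fun a b hab =>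
    Set.biInter_subset_biInter_left (by simpa using hab)
  have hlim := tendsto_measure_iInter_atTop (μ := P)
    (fun n => (Finset.measurableSet_biInter _ fun i _ => hA i).nullMeasurableSet) hanti
    ⟨0, measure_ne_top _ _⟩
  rw [hset]
  refine lt_of_lt_of_le (ENNReal.ofReal_pos.2 (Real.exp_pos (-∑' i, x i)))
    (ge_of_tendsto' hlim fun n => ?_)
  rw [Function.comp_apply, hind.meas_biInter, Finset.prod_congr rfl fun i _ => hprob i,
    ← ENNReal.ofReal_prod_of_nonneg fun i _ => Real.exp_nonneg _, ← Real.exp_sum,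
    Finset.sum_neg_distrib]
  gcongr
  exact hsum.sum_le_tsum _ fun i _ => hx i

lemma measure_failCount_eq_natCast_pos {Ω : Type*} [MeasurableSpace Ω]
    {P : Measure Ω} {A : ℕ → Set Ω} (hA : ∀ i, MeasurableSet (A i))
    (hind : iIndepSet A P) {x : ℕ → ℝ} (hx : ∀ i, 0 < x i) (hsum : Summable x)
    (hprob : ∀ i, P (A i) = ENNReal.ofReal (Real.exp (-x i))) (n : ℕ) :
    0 < P {ω | failCount A ω = n} := by
  induction n with
  | zero =>
    simpa using measure_failCount_eq_zero_pos hA hind (fun i => (hx i).le) hsum hprob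
  | succ n ih =>
    by_contra! h
    have hrec := natCast_succ_mul_measure_failCount_eq hA hind (fun i => (hx i).le) hprob n
    rw [nonpos_iff_eq_zero.1 h, mul_zero, eq_comm, ENNReal.tsum_eq_zero] at hrec
    have hnull : ∀ i, P ({ω | failCount A ω = n} ∩ A i) = 0 := fun i =>
      (mul_eq_zero.1 (hrec i)).resolve_left
        (ENNReal.ofReal_pos.2 (sub_pos.2 (Real.one_lt_exp_iff.2 (hx i)))).ne'
    refine ih.ne' (measure_mono_null (fun ω hω => ?_) (measure_iUnion_null hnull))
    by_contra hnot
    simp only [Set.mem_iUnion, Set.mem_inter_iff, not_exists, not_and] at hnot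
    have htop : failCount A ω = ⊤ := by
      rw [failCount, tsum_congr fun i => Set.indicator_of_mem (hnot i hω) _]
      exact ENNReal.tsum_const_eq_top_of_ne_zero one_ne_zero
    exact ENNReal.natCast_ne_top n (hω.symm.trans htop)

lemma sum_exp_sub_one_le {ι : Type*} (s : Finset ι) {x : ι → ℝ} (hx : ∀ i, 0 ≤ x i) :
    ∑ i ∈ s, (Real.exp (x i) - 1) ≤ Real.exp (∑ i ∈ s, x i) - 1 := by
  classical
  induction s using Finset.induction_on with
  | empty => simp
  | insert a s ha ih =>
    rw [Finset.sum_insert ha, Finset.sum_insert ha, Real.exp_add]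
    nlinarith [Real.one_le_exp (hx a),
      Real.one_le_exp (Finset.sum_nonneg fun i (_ : i ∈ s) => hx i)]

lemma tsum_ofReal_exp_sub_one_lt {ι : Type*} {x : ι → ℝ} (hx : ∀ i, 0 ≤ x i)
    (hsum : Summable x) :
    ∑' i, ENNReal.ofReal (Real.exp (x i) - 1) < ENNReal.ofReal (Real.exp (∑' i, x i)) := by
  have hle : ∑' i, ENNReal.ofReal (Real.exp (x i) - 1)
      ≤ ENNReal.ofReal (Real.exp (∑' i, x i) - 1) := by
    rw [ENNReal.tsum_eq_iSup_sum]
    refine iSup_le fun s => ?_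
    rw [← ENNReal.ofReal_sum_of_nonneg fun i _ => sub_nonneg.2 (Real.one_le_exp (hx i))]
    refine ENNReal.ofReal_le_ofReal ((sum_exp_sub_one_le s hx).trans ?_)
    gcongr
    exact hsum.sum_le_tsum _ fun i _ => hx i
  exact hle.trans_lt ((ENNReal.ofReal_lt_ofReal_iff (Real.exp_pos _)).2 (by linarith))

/-- For the counting variable `N = Σ_i 1_{Ω \ A_i}` of failed events among independent
events `A_i` with `P(A_i) = e^{−Tβ_i}` and `β = Σ β_i < ∞`: for every `k ≥ 1`,
`P(N = k) < (e^{Tβ}/k) · P(N = k − 1)`. -/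
theorem stmt_14 {Ω : Type*} [MeasurableSpace Ω] (P : Measure Ω) [IsProbabilityMeasure P]
    (T : ℝ) (hT : 0 < T) (β : ℕ → ℝ) (hβ : ∀ i, 0 < β i) (hsum : Summable β)
    (A : ℕ → Set Ω) (hA : ∀ i, MeasurableSet (A i)) (hind : iIndepSet A P)
    (hprob : ∀ i, P (A i) = ENNReal.ofReal (Real.exp (-(T * β i))))
    (N : Ω → ℝ≥0∞)
    (hN : ∀ ω, N ω = ∑' i, ((A i)ᶜ).indicator (fun _ => (1 : ℝ≥0∞)) ω)
    (k : ℕ) (hk : 1 ≤ k) :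
    P {ω | N ω = (k : ℝ≥0∞)}
      < ENNReal.ofReal (Real.exp (T * ∑' i, β i) / k) *
          P {ω | N ω = ((k - 1 : ℕ) : ℝ≥0∞)} := by
  obtain ⟨n, rfl⟩ := Nat.exists_eq_add_of_le' hk
  obtain rfl : N = failCount A := funext hN
  have hx : ∀ i, 0 < T * β i := fun i => mul_pos hT (hβ i)
  have hxs : Summable fun i => T * β i := hsum.mul_left T
  have hrec := natCast_succ_mul_measure_failCount_eq hA hind (fun i => (hx i).le) hprob n
  have hpos := measure_failCount_eq_natCast_pos hA hind hx hxs hprob n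
  rw [Nat.add_sub_cancel, ← tsum_mul_left, ENNReal.ofReal_div_of_pos (by positivity),
    ENNReal.ofReal_natCast, div_eq_mul_inv, mul_right_comm, ← div_eq_mul_inv,
    ENNReal.lt_div_iff_mul_lt (by simp) (by simp), mul_comm, hrec]
  calc ∑' i, ENNReal.ofReal (Real.exp (T * β i) - 1) * P ({ω | failCount A ω = n} ∩ A i)
      ≤ ∑' i, ENNReal.ofReal (Real.exp (T * β i) - 1) * P {ω | failCount A ω = n} := by
        gcongr
        exact Set.inter_subset_left
    _ = (∑' i, ENNReal.ofReal (Real.exp (T * β i) - 1)) * P {ω | failCount A ω = n} :=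
        ENNReal.tsum_mul_right
    _ < _ := ENNReal.mul_lt_mul_left hpos.ne' (measure_ne_top _ _)
        (tsum_ofReal_exp_sub_one_lt (fun i => (hx i).le) hxs)
end

section
/- The expectation of N satisfies E[N] < P(N = 0) · e^{T β} · exp(e^{T β}); in particular E[N] is finite. -/
open MeasureTheory ProbabilityTheory ENNReal

/-- Independent events of probability `exp (-c i)` with `c` summable all occur together with
probability at least `exp (-∑ c)`. -/
theorem ofReal_exp_neg_tsum_le_measure_iInter {Ω : Type*} [MeasurableSpace Ω] {P : Measure Ω}
    [IsFiniteMeasure P] {c : ℕ → ℝ} (hc : ∀ i, 0 ≤ c i) (hsum : Summable c) {A : ℕ → Set Ω}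
    (hA : ∀ i, MeasurableSet (A i)) (hind : iIndepSet A P)
    (hprob : ∀ i, P (A i) = ENNReal.ofReal (Real.exp (-c i))) :
    ENNReal.ofReal (Real.exp (-∑' i, c i)) ≤ P (⋂ i, A i) := by
  have hInter : ⋂ i, A i = ⋂ n : ℕ, ⋂ i ∈ Finset.range n, A i := by
    ext ω
    simp only [Set.mem_iInter, Finset.mem_range]
    exact ⟨fun h _ i _ => h i, fun h i => h (i + 1) i i.lt_succ_self⟩
  have hanti : Antitone fun n : ℕ => ⋂ i ∈ Finset.range n, A i := fun m n hmn =>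
    Set.biInter_subset_biInter_left fun _ hi => Finset.range_mono hmn hi
  rw [hInter]
  refine ge_of_tendsto' (tendsto_measure_iInter_atTop
    (fun n => (Finset.measurableSet_biInter _ fun i _ => hA i).nullMeasurableSet) hanti
    ⟨0, measure_ne_top P _⟩) fun n => ?_
  simp only [Function.comp_apply]
  rw [hind.meas_biInter, Finset.prod_congr rfl fun i _ => hprob i,
    ← ENNReal.ofReal_prod_of_nonneg fun i _ => (Real.exp_pos _).le, ← Real.exp_sum,
    Finset.sum_neg_distrib]
  gcongr
  exact hsum.sum_le_tsum _ fun i _ => hc i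

/-- The expected number of failures among events of probability `exp (-c i)` is at most `∑ c`. -/
theorem lintegral_tsum_indicator_compl_le {Ω : Type*} [MeasurableSpace Ω] {P : Measure Ω}
    [IsProbabilityMeasure P] {c : ℕ → ℝ} (hc : ∀ i, 0 ≤ c i) (hsum : Summable c) {A : ℕ → Set Ω}
    (hA : ∀ i, MeasurableSet (A i))
    (hprob : ∀ i, P (A i) = ENNReal.ofReal (Real.exp (-c i))) :
    ∫⁻ ω, ∑' i, ((A i)ᶜ).indicator (fun _ => (1 : ℝ≥0∞)) ω ∂P
      ≤ ENNReal.ofReal (∑' i, c i) := by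
  rw [lintegral_tsum fun i => (measurable_const.indicator (hA i).compl).aemeasurable,
    ENNReal.ofReal_tsum_of_nonneg hc hsum]
  refine ENNReal.tsum_le_tsum fun i => ?_
  rw [lintegral_indicator_const (hA i).compl, one_mul, prob_compl_eq_one_sub (hA i), hprob i,
    ← ENNReal.ofReal_one, ← ENNReal.ofReal_sub _ (Real.exp_pos _).le]
  exact ENNReal.ofReal_le_ofReal (by linarith [Real.add_one_le_exp (-c i)])

/-- For the counting variable `N = Σ_i 1_{Ω \ A_i}` of failed events among independent
events `A_i` with `P(A_i) = e^{−Tβ_i}` and `β = Σ β_i < ∞`, the expectation of `N`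
satisfies `E[N] < P(N = 0) · e^{Tβ} · exp(e^{Tβ})`; in particular `E[N]` is finite. -/
theorem stmt_16 {Ω : Type*} [MeasurableSpace Ω] (P : Measure Ω) [IsProbabilityMeasure P]
    (T : ℝ) (hT : 0 < T) (β : ℕ → ℝ) (hβ : ∀ i, 0 < β i) (hsum : Summable β)
    (A : ℕ → Set Ω) (hA : ∀ i, MeasurableSet (A i)) (hind : iIndepSet A P)
    (hprob : ∀ i, P (A i) = ENNReal.ofReal (Real.exp (-(T * β i))))
    (N : Ω → ℝ≥0∞)
    (hN : ∀ ω, N ω = ∑' i, ((A i)ᶜ).indicator (fun _ => (1 : ℝ≥0∞)) ω) :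
    ∫⁻ ω, N ω ∂P
      < P {ω | N ω = 0} *
          ENNReal.ofReal
            (Real.exp (T * ∑' i, β i) * Real.exp (Real.exp (T * ∑' i, β i))) := by
  have hc : ∀ i, 0 ≤ T * β i := fun i => (mul_pos hT (hβ i)).le
  have hcsum : Summable fun i => T * β i := hsum.mul_left T
  have hzero : {ω | N ω = 0} = ⋂ i, A i := by
    ext ω
    simp [hN, ENNReal.tsum_eq_zero]
  have hlower := ofReal_exp_neg_tsum_le_measure_iInter hc hcsum hA hind hprob
  have hupper := lintegral_tsum_indicator_compl_le hc hcsum hA hprob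
  rw [tsum_mul_left] at hlower hupper
  simp_rw [hzero, hN]
  set b := T * ∑' i, β i
  calc _ ≤ ENNReal.ofReal b := hupper
    _ < ENNReal.ofReal (Real.exp (Real.exp b)) :=
      (ENNReal.ofReal_lt_ofReal_iff (Real.exp_pos _)).2
        (by linarith [Real.add_one_le_exp b, Real.add_one_le_exp (Real.exp b)])
    _ = ENNReal.ofReal (Real.exp (-b)) *
          ENNReal.ofReal (Real.exp b * Real.exp (Real.exp b)) := by
      rw [← ENNReal.ofReal_mul (Real.exp_pos _).le, ← mul_assoc, ← Real.exp_add,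
        neg_add_cancel, Real.exp_zero, one_mul]
    _ ≤ _ := by gcongr
end
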